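/- For every positive integer m, ∫₀¹ (log‖x‖ + 1 + log 2) cos(2πmx) dx = -1/(2m) + c_m, where c_m = (1/(πm)) ∫_{πm}^∞ (sin t)/t dt, and |c_m| ≤ C/m² for some absolute constant C. -/

import Mathlib

/-- Distance from `x` to the nearest integer. -/
noncomputable def nint (x : ℝ) : ℝ := |x - (round x : ℝ)|

open MeasureTheory Set Real in
lemma aux_exp_int {T : ℝ} (hT : 0 < T) :
    IntegrableOn (fun s : ℝ => exp (-(T * s))) (Ioi 0) ∧
    ∫ s in Ioi (0:ℝ), exp (-(T * s)) = 1 / T := by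
  have h1 : (fun s : ℝ => exp (-(T * s))) = fun s => exp ((-T) * s) := by
    ext s; ring_nf
  rw [h1]
  refine ⟨integrableOn_exp_mul_Ioi (by linarith) 0, ?_⟩
  rw [integral_exp_mul_Ioi (by linarith) 0]
  simp

open MeasureTheory Set Real in
lemma aux_inner (T s : ℝ) :
    ∫ t in (0:ℝ)..T, sin t * exp (-(t * s)) =
      (1 + s ^ 2)⁻¹ - exp (-(T * s)) * (s * sin T + cos T) / (1 + s ^ 2) := by
  have hne : (1 + s ^ 2) ≠ 0 := by positivity
  rw [intervalIntegral.integral_eq_sub_of_hasDerivAt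
    (f := fun t => - (exp (-(t * s)) * (s * sin t + cos t) / (1 + s ^ 2)))]
  · simp; ring
  · intro t _
    have h1 : HasDerivAt (fun t : ℝ => exp (-(t * s))) (exp (-(t * s)) * (-(1 * s))) t :=
      (((hasDerivAt_id t).mul_const s).neg).exp
    have h2 : HasDerivAt (fun t : ℝ => s * sin t + cos t) (s * cos t + - sin t) t :=
      ((hasDerivAt_sin t).const_mul s).add (hasDerivAt_cos t)
    have h3 := ((h1.mul h2).div_const (1 + s ^ 2)).neg
    refine h3.congr_deriv ?_
    field_simp
    ring
  · apply Continuous.intervalIntegrable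
    fun_prop

open MeasureTheory Set Real in
lemma aux_Si {T : ℝ} (hT : 0 < T) :
    |π / 2 - ∫ t in (0:ℝ)..T, sinc t| ≤ 2 / T := by
  have hint : Integrable (Function.uncurry fun t s : ℝ => sin t * exp (-(t * s)))
      ((volume.restrict (Ioc 0 T)).prod (volume.restrict (Ioi 0))) := by
    rw [integrable_prod_iff]
    · constructor
      · filter_upwards [ae_restrict_mem measurableSet_Ioc] with t ht
        exact Integrable.const_mul (aux_exp_int ht.1).1 (sin t)
      · have : Integrable (fun t => |sinc t|) (volume.restrict (Ioc 0 T)) :=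
          ((continuous_sinc.abs.integrableOn_Icc (a := 0) (b := T)).mono_set Ioc_subset_Icc_self)
        refine this.congr ?_
        filter_upwards [ae_restrict_mem measurableSet_Ioc] with t ht
        simp only [Function.uncurry, norm_mul, Real.norm_eq_abs, abs_exp]
        rw [integral_const_mul, (aux_exp_int ht.1).2, sinc_of_ne_zero ht.1.ne', abs_div,
          abs_of_pos ht.1]
        ring
    · apply Continuous.aestronglyMeasurable
      fun_prop
  have h1 : ∫ t in (0:ℝ)..T, sinc t =
      ∫ t in Ioc 0 T, ∫ s in Ioi (0:ℝ), sin t * exp (-(t * s)) := by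
    rw [intervalIntegral.integral_of_le hT.le]
    refine setIntegral_congr_fun measurableSet_Ioc fun t ht => ?_
    rw [integral_const_mul, (aux_exp_int ht.1).2, sinc_of_ne_zero ht.1.ne']
    ring
  have hb : ∀ s ∈ Ioi (0:ℝ), ‖exp (-(T * s)) * (s * sin T + cos T) / (1 + s ^ 2)‖
      ≤ 2 * exp (-(T * s)) := by
    intro s hs
    have hs : 0 < s := hs
    rw [Real.norm_eq_abs, abs_div, abs_mul, abs_exp, abs_of_pos (by positivity : 0 < 1 + s ^ 2),
      div_le_iff₀ (by positivity)]
    have : |s * sin T + cos T| ≤ s + 1 := by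
      refine (abs_add_le _ _).trans ?_
      rw [abs_mul, abs_of_pos hs]
      nlinarith [abs_sin_le_one T, abs_cos_le_one T]
    have h2 : |s * sin T + cos T| ≤ 2 * (1 + s ^ 2) := by nlinarith [sq_nonneg (s - 1)]
    nlinarith [exp_pos (-(T * s))]
  have hbi : IntegrableOn (fun s : ℝ => 2 * exp (-(T * s))) (Ioi 0) :=
    (aux_exp_int hT).1.const_mul 2
  have hRi : IntegrableOn
      (fun s : ℝ => exp (-(T * s)) * (s * sin T + cos T) / (1 + s ^ 2)) (Ioi 0) := by
    refine Integrable.mono' hbi ?_ ?_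
    · apply Continuous.aestronglyMeasurable
      have : ∀ s : ℝ, 1 + s ^ 2 ≠ 0 := fun s => by positivity
      fun_prop (disch := exact this _)
    · filter_upwards [ae_restrict_mem measurableSet_Ioi] with s hs using hb s hs
  have h2 : ∫ t in (0:ℝ)..T, sinc t =
      π / 2 - ∫ s in Ioi (0:ℝ), exp (-(T * s)) * (s * sin T + cos T) / (1 + s ^ 2) := by
    rw [h1, integral_integral_swap hint]
    have : ∀ s : ℝ, ∫ t in Ioc 0 T, sin t * exp (-(t * s)) =
      (1 + s ^ 2)⁻¹ - exp (-(T * s)) * (s * sin T + cos T) / (1 + s ^ 2) := by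
      intro s
      rw [← intervalIntegral.integral_of_le hT.le, aux_inner]
    simp_rw [this]
    rw [integral_sub integrable_inv_one_add_sq.integrableOn hRi, integral_Ioi_inv_one_add_sq]
    simp
  rw [h2, sub_sub_cancel, ← Real.norm_eq_abs]
  refine (norm_integral_le_of_norm_le hbi ?_).trans ?_
  · filter_upwards [ae_restrict_mem measurableSet_Ioi] with s hs using hb s hs
  · rw [integral_const_mul, (aux_exp_int hT).2]
    apply le_of_eq; ring

open MeasureTheory Set Real in
lemma aux_half (m : ℕ) (hm : 1 ≤ m) (K : ℝ) :
    IntervalIntegrable (fun x => (log x + K) * cos (2 * π * m * x)) volume 0 (1/2) ∧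
    ∫ x in (0:ℝ)..(1/2), (log x + K) * cos (2 * π * m * x) =
      - (∫ t in (0:ℝ)..(π * m), sinc t) / (2 * π * m) := by
  have hm' : (0:ℝ) < m := by exact_mod_cast hm
  have hw : (0:ℝ) < 2 * π * m := by positivity
  have hI : IntervalIntegrable (fun x => (log x + K) * cos (2 * π * m * x)) volume 0 (1/2) := by
    apply IntervalIntegrable.mul_continuousOn
    · exact intervalIntegral.intervalIntegrable_log'.add intervalIntegrable_const
    · fun_prop
  have hS : IntervalIntegrable (fun x => sinc (2 * π * m * x)) volume 0 (1/2) :=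
    (continuous_sinc.comp (by fun_prop : Continuous fun x : ℝ => 2 * π * m * x)).intervalIntegrable
      _ _
  refine ⟨hI, ?_⟩
  have key := intervalIntegral.integral_eq_sub_of_hasDerivAt_of_le (a := 0) (b := 1/2)
    (f := fun x : ℝ => (x * log x) * sinc (2 * π * m * x) + K * sin (2 * π * m * x) / (2 * π * m))
    (f' := fun x => (log x + K) * cos (2 * π * m * x) + sinc (2 * π * m * x))
    (by norm_num) ?_ ?_ (hI.add hS)
  · rw [intervalIntegral.integral_add hI hS] at key
    have e1 : sin (2 * π * m * (1/2)) = 0 := by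
      rw [show 2 * π * m * (1/2) = m * π by ring]; exact sin_nat_mul_pi m
    have e2 : sinc (2 * π * m * (1/2)) = 0 := by
      rw [sinc_of_ne_zero (by positivity), e1, zero_div]
    have e3 : ∫ x in (0:ℝ)..(1/2), sinc (2 * π * m * x) =
        (∫ t in (0:ℝ)..(π * m), sinc t) / (2 * π * m) := by
      rw [intervalIntegral.integral_comp_mul_left _ hw.ne', smul_eq_mul]
      rw [show 2 * π * m * (1/2) = π * m by ring, mul_zero]
      ring
    simp only [e1, e2, e3] at key
    simp only [mul_zero, sin_zero, zero_div, zero_mul, sub_zero, add_zero] at key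
    rw [neg_div]; linarith
  · apply Continuous.continuousOn
    have h1 := continuous_mul_log
    have h2 : Continuous fun x : ℝ => sinc (2 * π * m * x) :=
      continuous_sinc.comp (by fun_prop)
    exact (h1.mul h2).add (by fun_prop)
  · intro x hx
    have hx0 : 0 < x := hx.1
    have hl : HasDerivAt (fun x : ℝ => sin (2 * π * m * x))
        (cos (2 * π * m * x) * (2 * π * m)) x := by
      simpa using ((hasDerivAt_id x).const_mul (2 * π * m)).sin
    have h3 : HasDerivAt (fun x : ℝ => (log x + K) * sin (2 * π * m * x) / (2 * π * m))
        ((x⁻¹ * sin (2 * π * m * x) + (log x + K) * (cos (2 * π * m * x) * (2 * π * m)))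
          / (2 * π * m)) x :=
      ((((hasDerivAt_log hx0.ne').add_const K).mul hl).div_const _)
    have h4 := h3.congr_of_eventuallyEq (f₁ := fun x : ℝ => (x * log x) * sinc (2 * π * m * x)
      + K * sin (2 * π * m * x) / (2 * π * m)) ?_
    · refine h4.congr_deriv ?_
      rw [sinc_of_ne_zero (by positivity)]
      field_simp
      ring
    · filter_upwards [lt_mem_nhds hx0] with y hy
      rw [sinc_of_ne_zero (by positivity)]
      field_simp

lemma nint_left {x : ℝ} (h0 : 0 ≤ x) (h1 : x ≤ 1/2) : nint x = x := by
  unfold nint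
  rw [abs_sub_round_eq_min, Int.fract_eq_self.2 ⟨h0, by linarith⟩]
  exact min_eq_left (by linarith)

lemma nint_right {x : ℝ} (h0 : 0 ≤ x) (h1 : x ≤ 1/2) : nint (1 - x) = x := by
  rcases h0.eq_or_lt with rfl | h0
  · simp [nint]
  unfold nint
  rw [abs_sub_round_eq_min, Int.fract_eq_self.2 ⟨by linarith, by linarith⟩]
  rw [min_eq_right (by linarith)]; ring

open MeasureTheory Set Real in
lemma aux_full (m : ℕ) (hm : 1 ≤ m) :
    (∫ x in (0:ℝ)..1, (log (nint x) + 1 + log 2) * cos (2 * π * m * x)) =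
      - (∫ t in (0:ℝ)..(π * m), sinc t) / (π * m) := by
  obtain ⟨hI, hv⟩ := aux_half m hm (1 + log 2)
  set f : ℝ → ℝ := fun x => (log (nint x) + 1 + log 2) * cos (2 * π * m * x) with hf
  have hL : EqOn (fun x => (log x + (1 + log 2)) * cos (2 * π * m * x)) f (uIcc 0 (1/2)) := by
    intro x hx
    rw [uIcc_of_le (by norm_num)] at hx
    simp only [hf, nint_left hx.1 hx.2]; ring
  have hR : EqOn (fun x => (log x + (1 + log 2)) * cos (2 * π * m * x)) (fun x => f (1 - x))
      (uIcc 0 (1/2)) := by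
    intro x hx
    rw [uIcc_of_le (by norm_num)] at hx
    simp only [hf, nint_right hx.1 hx.2]
    have : cos (2 * π * m * (1 - x)) = cos (2 * π * m * x) := by
      rw [show 2 * π * m * (1 - x) = m * (2 * π) - 2 * π * m * x by ring]
      exact cos_nat_mul_two_pi_sub _ _
    rw [this]; ring
  have i1 : IntervalIntegrable f volume 0 (1/2) :=
    hI.congr (fun x hx => hL (uIoc_subset_uIcc hx))
  have i2 : IntervalIntegrable f volume (1/2) 1 := by
    have h : IntervalIntegrable (fun x => f (1 - x)) volume 0 (1/2) :=
      hI.congr (fun x hx => hR (uIoc_subset_uIcc hx))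
    have := (h.comp_sub_left 1).symm
    norm_num at this
    convert this using 1
  have v1 := intervalIntegral.integral_congr (μ := volume) hL
  have v2 := intervalIntegral.integral_congr (μ := volume) hR
  rw [intervalIntegral.integral_comp_sub_left] at v2
  norm_num only at v2
  rw [← intervalIntegral.integral_add_adjacent_intervals i1 i2, ← v1, ← v2, hv]
  have hm' : (0:ℝ) < m := by exact_mod_cast hm
  field_simp
  ring

theorem stmt1 : ∃ C : ℝ, 0 < C ∧ ∀ m : ℕ, 1 ≤ m → ∃ c : ℝ,
    Filter.Tendsto (fun T : ℝ => ∫ t in (Real.pi * m)..T, Real.sin t / t) Filter.atTop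
      (nhds (Real.pi * m * c)) ∧
    |c| ≤ C / (m : ℝ) ^ 2 ∧
    (∫ x in (0:ℝ)..1, (Real.log (nint x) + 1 + Real.log 2) * Real.cos (2 * Real.pi * m * x))
      = -1 / (2 * m) + c := by
  refine ⟨1, one_pos, fun m hm => ?_⟩
  have hm' : (0:ℝ) < m := by exact_mod_cast hm
  have hpm : 0 < Real.pi * m := by positivity
  refine ⟨(Real.pi / 2 - ∫ t in (0:ℝ)..(Real.pi * m), Real.sinc t) / (Real.pi * m), ?_, ?_, ?_⟩
  · rw [mul_div_cancel₀ _ hpm.ne']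
    have hlim : Filter.Tendsto (fun T : ℝ => ∫ t in (0:ℝ)..T, Real.sinc t) Filter.atTop
        (nhds (Real.pi / 2)) := by
      rw [tendsto_iff_norm_sub_tendsto_zero]
      refine squeeze_zero' (g := fun T : ℝ => 2 / T) (Filter.Eventually.of_forall fun _ => norm_nonneg _)
        ?_ (tendsto_const_nhds.div_atTop Filter.tendsto_id)
      filter_upwards [Filter.eventually_gt_atTop 0] with T hT
      rw [norm_sub_rev]
      exact aux_Si hT
    refine (hlim.sub_const _).congr' ?_
    filter_upwards [Filter.eventually_ge_atTop (Real.pi * m)] with T hT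
    rw [intervalIntegral.integral_interval_sub_left
      (Real.continuous_sinc.intervalIntegrable _ _) (Real.continuous_sinc.intervalIntegrable _ _)]
    refine intervalIntegral.integral_congr fun t ht => ?_
    rw [Set.uIcc_of_le hT] at ht
    exact Real.sinc_of_ne_zero (hpm.trans_le ht.1).ne'
  · rw [abs_div, abs_of_pos hpm, div_le_div_iff₀ hpm (by positivity)]
    have h := aux_Si hpm
    rw [le_div_iff₀ hpm] at h
    set A := |Real.pi / 2 - ∫ t in (0:ℝ)..(Real.pi * m), Real.sinc t|
    have h3 := Real.pi_gt_three
    have hA : 0 ≤ A := abs_nonneg _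
    have hAm : 0 ≤ A * m := by positivity
    have : A * m ≤ Real.pi := by nlinarith
    nlinarith
  · rw [aux_full m hm]
    field_simp
    ring
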